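/- Let X be a real random variable with E X = 0, E X² = 1, E|X|^p < ∞ and E|X|^{2+δ} < ∞, where p > 1 and 0 < δ < min(1, p−1). For every γ > 0 there exist constants C > 0 and R > 0 such that, with h(x,t) := max( V̄_p(x+R, t) − C |x+R|^{p−δ}, 0 ), one has E[h(x+X, t+1)] ≤ h(x,t) for all t ≥ 0 and all x ≥ (c(p)+γ)√t. -/

import Mathlib

open MeasureTheory ProbabilityTheory Real Set Filter
open scoped ENNReal NNReal ProbabilityTheory

noncomputable section

/-- Auxiliary recursion defining the functions `ψ_p`. -/
def psiAux : ℕ → ℝ → ℝ → ℝ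
  | 0, p, x => (Real.Gamma (-p))⁻¹ *
      ∫ s in Set.Ioi (0 : ℝ), Real.exp (-x * s - s ^ 2 / 2) * s ^ (-p - 1)
  | (n + 1), p, x =>
      if p < 0 then
        (Real.Gamma (-p))⁻¹ *
          ∫ s in Set.Ioi (0 : ℝ), Real.exp (-x * s - s ^ 2 / 2) * s ^ (-p - 1)
      else x * psiAux n (p - 1) x + (1 - p) * psiAux n (p - 2) x

/-- `ψ_p(x)`: for `p < 0` given by the integral representation
`ψ_p(x) = Γ(-p)⁻¹ ∫₀^∞ exp(-xs - s²/2) s^{-p-1} ds`; for `p ≥ 0` defined by iterating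
the recurrence `ψ_p(x) = x ψ_{p-1}(x) + (1-p) ψ_{p-2}(x)`. -/
def psi (p x : ℝ) : ℝ := psiAux (⌈p⌉₊ + 1) p x

/-- `V_p(x,t) = t^{p/2} ψ_p(x/√t)` for `t > 0`, and `V_p(x,0) = x^p`. -/
def V (p x t : ℝ) : ℝ :=
  if t = 0 then x ^ p else t ^ (p / 2) * psi p (x / Real.sqrt t)

/-- `c(p)`: the largest real zero of `ψ_p`. -/
def cRoot (p : ℝ) : ℝ := sSup {x : ℝ | psi p x = 0}

/-- `p(c)`: the minimal positive root of `p ↦ ψ_p(c)`. -/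
def pRoot (c : ℝ) : ℝ := sInf {p : ℝ | 0 < p ∧ psi p c = 0}

/-- `V̄_p(x,t) = V_p(x,t)` if `x ≥ c(p)√t`, and `0` otherwise. -/
def Vbar (p x t : ℝ) : ℝ := if cRoot p * Real.sqrt t ≤ x then V p x t else 0

variable {Ω : Type*}

/-- The random walk `S(n) = X₁ + ⋯ + Xₙ` (with increments `X 0, X 1, …`). -/
def S (X : ℕ → Ω → ℝ) (n : ℕ) (ω : Ω) : ℝ := ∑ i ∈ Finset.range n, X i ω

/-- The stopping time `T_{a,b} = inf {n ≥ 1 : a + S(n) ≤ c √(n+b)}`, valued in `ℕ∞`. -/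
def hitT (c a b : ℝ) (X : ℕ → Ω → ℝ) (ω : Ω) : ℕ∞ :=
  sInf {m : ℕ∞ | ∃ k : ℕ, m = k ∧ 1 ≤ k ∧ a + S X k ω ≤ c * Real.sqrt ((k : ℝ) + b)}

/-- The integral `∫₀^∞ exp(-xs - s²/2) s^{a-1} ds`, which equals `Γ(a) ψ_{-a}(x)` for `a > 0`. -/
def gaussLaplace (a x : ℝ) : ℝ :=
  ∫ s in Set.Ioi (0 : ℝ), Real.exp (-x * s - s ^ 2 / 2) * s ^ (a - 1)

lemma measurable_gaussLaplace_integrand (a x : ℝ) :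
    Measurable fun s : ℝ => Real.exp (-x * s - s ^ 2 / 2) * s ^ (a - 1) := by
  fun_prop

lemma gaussLaplace_integrand_le {a x r s : ℝ} (hx : |x| ≤ r) (hs : 0 < s) :
    Real.exp (-x * s - s ^ 2 / 2) * s ^ (a - 1)
      ≤ Real.exp (r ^ 2) * (s ^ (a - 1) * Real.exp (-(1 / 4) * s ^ 2)) := by
  have h1 : -x * s - s ^ 2 / 2 ≤ r ^ 2 + -(1 / 4) * s ^ 2 := by
    have h2 : -x ≤ r := (neg_le_abs x).trans hx
    nlinarith [sq_nonneg (s / 2 - r), mul_le_mul_of_nonneg_right h2 hs.le]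
  calc Real.exp (-x * s - s ^ 2 / 2) * s ^ (a - 1)
      ≤ Real.exp (r ^ 2 + -(1 / 4) * s ^ 2) * s ^ (a - 1) := by
        gcongr
    _ = _ := by rw [Real.exp_add]; ring

lemma integrableOn_gaussLaplace_majorant {a : ℝ} (ha : 0 < a) (r : ℝ) :
    IntegrableOn (fun s : ℝ => Real.exp (r ^ 2) * (s ^ (a - 1) * Real.exp (-(1 / 4) * s ^ 2)))
      (Set.Ioi 0) :=
  (integrableOn_rpow_mul_exp_neg_mul_sq (by norm_num) (by linarith)).const_mul _

lemma integrableOn_gaussLaplace {a : ℝ} (ha : 0 < a) (x : ℝ) :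
    IntegrableOn (fun s : ℝ => Real.exp (-x * s - s ^ 2 / 2) * s ^ (a - 1)) (Set.Ioi 0) := by
  refine (integrableOn_gaussLaplace_majorant ha |x|).mono'
    (measurable_gaussLaplace_integrand a x).aestronglyMeasurable ?_
  filter_upwards [ae_restrict_mem measurableSet_Ioi] with s hs
  have hs : 0 < s := hs
  rw [Real.norm_of_nonneg (by positivity)]
  exact gaussLaplace_integrand_le le_rfl hs

lemma gaussLaplace_pos {a : ℝ} (ha : 0 < a) (x : ℝ) : 0 < gaussLaplace a x := by
  refine (setIntegral_pos_iff_support_of_nonneg_ae ?_ (integrableOn_gaussLaplace ha x)).2 ?_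
  · filter_upwards [ae_restrict_mem measurableSet_Ioi] with s hs
    have hs : 0 < s := hs
    simp only [Pi.zero_apply]
    positivity
  · have : Set.Ioi (0 : ℝ) ⊆ Function.support
        (fun s : ℝ => Real.exp (-x * s - s ^ 2 / 2) * s ^ (a - 1)) ∩ Set.Ioi 0 := by
      intro s hs
      have hs' : 0 < s := hs
      exact ⟨by simp only [Function.mem_support]; positivity, hs⟩
    exact lt_of_lt_of_le (by simp) (measure_mono this)

lemma hasDerivAt_gaussLaplace {a : ℝ} (ha : 0 < a) (x : ℝ) :
    HasDerivAt (gaussLaplace a) (-gaussLaplace (a + 1) x) x := by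
  have key := hasDerivAt_integral_of_dominated_loc_of_deriv_le
    (μ := volume.restrict (Set.Ioi (0 : ℝ)))
    (F := fun x s : ℝ => Real.exp (-x * s - s ^ 2 / 2) * s ^ (a - 1))
    (F' := fun x s : ℝ => -(Real.exp (-x * s - s ^ 2 / 2) * s ^ (a + 1 - 1)))
    (x₀ := x) (bound := fun s => Real.exp ((|x| + 1) ^ 2) *
      (s ^ (a + 1 - 1) * Real.exp (-(1 / 4) * s ^ 2)))
    (Metric.ball_mem_nhds x one_pos)
    (Eventually.of_forall fun y => (measurable_gaussLaplace_integrand a y).aestronglyMeasurable)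
    (integrableOn_gaussLaplace ha x)
    (measurable_gaussLaplace_integrand (a + 1) x).neg.aestronglyMeasurable
    ?_ (integrableOn_gaussLaplace_majorant (by linarith) _) ?_
  · have h := key.2
    rw [integral_neg] at h
    exact h
  · filter_upwards [ae_restrict_mem measurableSet_Ioi] with s hs y hy
    have hs : 0 < s := hs
    rw [norm_neg, Real.norm_of_nonneg (by positivity)]
    refine gaussLaplace_integrand_le ?_ hs
    rw [Metric.mem_ball, Real.dist_eq] at hy
    have := abs_add_le (y - x) x
    rw [sub_add_cancel] at this
    linarith
  · filter_upwards [ae_restrict_mem measurableSet_Ioi] with s hs y _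
    have hs : 0 < s := hs
    have h1 : HasDerivAt (fun y : ℝ => -y * s - s ^ 2 / 2) (-1 * s) y :=
      ((hasDerivAt_id y).neg.mul_const s).sub_const _
    refine (h1.exp.mul_const (s ^ (a - 1))).congr_deriv ?_
    rw [show a + 1 - 1 = (a - 1) + 1 by ring, Real.rpow_add_one hs.ne']
    ring

lemma mul_gaussLaplace {a : ℝ} (ha : 0 < a) (x : ℝ) :
    a * gaussLaplace a x = x * gaussLaplace (a + 1) x + gaussLaplace (a + 2) x := by
  have hI := integrableOn_gaussLaplace ha x
  have hI1 := integrableOn_gaussLaplace (a := a + 1) (by linarith) x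
  have hI2 := integrableOn_gaussLaplace (a := a + 2) (by linarith) x
  have key := integral_Ioi_of_hasDerivAt_of_tendsto
    (f := fun s : ℝ => Real.exp (-x * s - s ^ 2 / 2) * s ^ a)
    (f' := fun s : ℝ => a * (Real.exp (-x * s - s ^ 2 / 2) * s ^ (a - 1))
      - x * (Real.exp (-x * s - s ^ 2 / 2) * s ^ (a + 1 - 1))
      - Real.exp (-x * s - s ^ 2 / 2) * s ^ (a + 2 - 1)) (a := 0) (m := 0) ?_ ?_
    (((hI.const_mul a).sub (hI1.const_mul x)).sub hI2) ?_
  · have e1 := integral_sub ((hI.const_mul a).sub (hI1.const_mul x)) hI2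
    simp only [Pi.sub_apply] at e1
    rw [e1, integral_sub (hI.const_mul a) (hI1.const_mul x), integral_const_mul,
      integral_const_mul, Real.zero_rpow ha.ne', mul_zero, sub_zero] at key
    simp only [gaussLaplace]
    linarith
  · exact (Continuous.mul (by fun_prop)
      (Real.continuous_rpow_const ha.le)).continuousWithinAt
  · intro s hs
    have hs : 0 < s := hs
    have h1 : HasDerivAt (fun s : ℝ => -x * s - s ^ 2 / 2) (-x - s) s := by
      refine (((hasDerivAt_id s).const_mul (-x)).sub
        ((hasDerivAt_pow 2 s).div_const 2)).congr_deriv ?_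
      push_cast
      ring
    refine (h1.exp.mul (Real.hasDerivAt_rpow_const (p := a) (Or.inl hs.ne'))).congr_deriv ?_
    have e1 : s ^ a = s ^ (a - 1) * s := by
      rw [← Real.rpow_add_one hs.ne']; ring_nf
    rw [show a + 1 - 1 = a by ring, show a + 2 - 1 = a + 1 by ring, Real.rpow_add_one hs.ne', e1]
    ring
  · have h0 := (tendsto_rpow_mul_exp_neg_mul_atTop_nhds_zero a 1 one_pos).const_mul
      (Real.exp ((|x| + 1) ^ 2))
    rw [mul_zero] at h0
    refine squeeze_zero' ?_ ?_ h0
    · filter_upwards [eventually_gt_atTop 0] with s hs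
      positivity
    · filter_upwards [eventually_gt_atTop 0] with s hs
      have h1 : -x * s - s ^ 2 / 2 ≤ (|x| + 1) ^ 2 + -1 * s := by
        nlinarith [sq_nonneg (s - (|x| + 1)), mul_le_mul_of_nonneg_right (neg_le_abs x) hs.le]
      calc Real.exp (-x * s - s ^ 2 / 2) * s ^ a
          ≤ Real.exp ((|x| + 1) ^ 2 + -1 * s) * s ^ a := by gcongr
        _ = _ := by rw [Real.exp_add]; ring

lemma gaussLaplace_le {a x : ℝ} (ha : 0 < a) (hx : 0 < x) :
    gaussLaplace a x ≤ x ^ (-a) * Real.Gamma a := by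
  have hG := Real.integral_rpow_mul_exp_neg_mul_Ioi ha hx
  rw [one_div, Real.inv_rpow hx.le, ← Real.rpow_neg hx.le] at hG
  rw [← hG]
  have hint : IntegrableOn (fun t : ℝ => t ^ (a - 1) * Real.exp (-(x * t))) (Set.Ioi 0) := by
    have := integrableOn_rpow_mul_exp_neg_mul_rpow (p := 1) (s := a - 1) (b := x)
      (by linarith) one_pos hx
    simpa [neg_mul] using this
  refine setIntegral_mono_on (integrableOn_gaussLaplace ha x) hint measurableSet_Ioi ?_
  intro s hs
  have hs : 0 < s := hs
  rw [mul_comm]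
  gcongr
  nlinarith [sq_nonneg s]

lemma le_gaussLaplace {a x : ℝ} (ha : 0 < a) (hx : 0 < x) :
    x ^ (-a) * Real.Gamma a - x ^ (-(a + 2)) * Real.Gamma (a + 2) / 2 ≤ gaussLaplace a x := by
  have hG := Real.integral_rpow_mul_exp_neg_mul_Ioi ha hx
  have hG2 := Real.integral_rpow_mul_exp_neg_mul_Ioi (a := a + 2) (by linarith) hx
  rw [one_div, Real.inv_rpow hx.le, ← Real.rpow_neg hx.le] at hG hG2
  rw [← hG, ← hG2, ← integral_div]
  have hint : ∀ a : ℝ, 0 < a →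
      IntegrableOn (fun t : ℝ => t ^ (a - 1) * Real.exp (-(x * t))) (Set.Ioi 0) := by
    intro a ha
    have := integrableOn_rpow_mul_exp_neg_mul_rpow (p := 1) (s := a - 1) (b := x)
      (by linarith) one_pos hx
    simpa [neg_mul] using this
  have h2 := (hint (a + 2) (by linarith)).div_const 2
  rw [← integral_sub (hint a ha) h2]
  refine setIntegral_mono_on ((hint a ha).sub h2) (integrableOn_gaussLaplace ha x)
    measurableSet_Ioi ?_
  intro s hs
  have hs : 0 < s := hs
  have e1 : s ^ (a + 2 - 1) = s ^ (a - 1) * s ^ 2 := by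
    rw [show a + 2 - 1 = (a - 1) + (2 : ℕ) by push_cast; ring, Real.rpow_add_natCast hs.ne']
  have e2 : Real.exp (-x * s - s ^ 2 / 2) = Real.exp (-(x * s)) * Real.exp (-(s ^ 2 / 2)) := by
    rw [← Real.exp_add]; ring_nf
  have h3 := Real.add_one_le_exp (-(s ^ 2 / 2))
  have h4 : 0 ≤ s ^ (a - 1) * Real.exp (-(x * s)) := by positivity
  rw [e1, e2]
  nlinarith [mul_le_mul_of_nonneg_left h3 h4]

lemma psiAux_of_neg {q : ℝ} (hq : q < 0) (n : ℕ) (x : ℝ) :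
    psiAux n q x = (Real.Gamma (-q))⁻¹ * gaussLaplace (-q) x := by
  cases n <;> simp [psiAux, gaussLaplace, hq]

lemma psiAux_congr {n m : ℕ} {q : ℝ} (hn : q < n) (hm : q < m) (x : ℝ) :
    psiAux n q x = psiAux m q x := by
  induction n generalizing m q with
  | zero =>
    have hq : q < 0 := by simpa using hn
    rw [psiAux_of_neg hq, psiAux_of_neg hq]
  | succ n ih =>
    by_cases hq : q < 0
    · rw [psiAux_of_neg hq, psiAux_of_neg hq]
    cases m with
    | zero => exact absurd (by simpa using hm) hq
    | succ m =>
      push_cast at hn hm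
      simp only [psiAux, if_neg hq]
      rw [ih (m := m) (q := q - 1) (by linarith) (by linarith),
        ih (m := m) (q := q - 2) (by linarith) (by linarith)]

lemma psi_eq_psiAux {n : ℕ} {q : ℝ} (hn : q < n) (x : ℝ) : psi q x = psiAux n q x :=
  psiAux_congr (by push_cast; linarith [Nat.le_ceil q]) hn x

lemma psi_of_neg {q : ℝ} (hq : q < 0) (x : ℝ) :
    psi q x = (Real.Gamma (-q))⁻¹ * gaussLaplace (-q) x :=
  psiAux_of_neg hq _ x

lemma psi_recurrence (q x : ℝ) : psi q x = x * psi (q - 1) x + (1 - q) * psi (q - 2) x := by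
  by_cases hq : q < 0
  · rw [psi_of_neg hq, psi_of_neg (q := q - 1) (by linarith), psi_of_neg (q := q - 2) (by linarith)]
    obtain ⟨a, rfl⟩ : ∃ a, q = -a := ⟨-q, by ring⟩
    have ha : 0 < a := by linarith
    have h := mul_gaussLaplace ha x
    have g1 : Real.Gamma (a + 1) = a * Real.Gamma a := Real.Gamma_add_one ha.ne'
    have g2 : Real.Gamma (a + 2) = (a + 1) * (a * Real.Gamma a) := by
      rw [show a + 2 = (a + 1) + 1 by ring, Real.Gamma_add_one (by linarith), g1]
    have hG := Real.Gamma_pos_of_pos ha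
    rw [show -(-a - 1) = a + 1 by ring, show -(-a - 2) = a + 2 by ring, neg_neg, g1, g2]
    have ha1 : a + 1 ≠ 0 := by linarith
    have e : gaussLaplace a x = (x * gaussLaplace (a + 1) x + gaussLaplace (a + 2) x) / a := by
      rw [← h]; field_simp
    rw [e]
    field_simp
    ring
  · have hc : q < (⌈q⌉₊ : ℝ) + 1 := by linarith [Nat.le_ceil q]
    rw [psi_eq_psiAux (q := q - 1) (n := ⌈q⌉₊) (by linarith),
      psi_eq_psiAux (q := q - 2) (n := ⌈q⌉₊) (by linarith)]
    simp only [psi, psiAux, if_neg hq]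

lemma hasDerivAt_psi (q x : ℝ) : HasDerivAt (psi q) (q * psi (q - 1) x) x := by
  have main : ∀ n : ℕ, ∀ q : ℝ, q < n → HasDerivAt (psi q) (q * psi (q - 1) x) x := by
    intro n
    induction n with
    | zero =>
      intro q hq
      have hq : q < 0 := by simpa using hq
      have e : psi q = fun x => (Real.Gamma (-q))⁻¹ * gaussLaplace (-q) x :=
        funext (psi_of_neg hq)
      rw [e, psi_of_neg (q := q - 1) (by linarith)]
      refine ((hasDerivAt_gaussLaplace (a := -q) (by linarith) x).const_mul _).congr_deriv ?_
      have hG := Real.Gamma_pos_of_pos (s := -q) (by linarith)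
      have hG1 : Real.Gamma (-q + 1) = -q * Real.Gamma (-q) := Real.Gamma_add_one (by linarith)
      rw [show -(q - 1) = -q + 1 by ring, hG1]
      have := hq.ne
      field_simp
    | succ n ih =>
      intro q hq
      push_cast at hq
      have e : psi q = fun x => x * psi (q - 1) x + (1 - q) * psi (q - 2) x :=
        funext (psi_recurrence q)
      rw [e]
      have h1 := ih (q - 1) (by linarith)
      have h2 := ih (q - 2) (by linarith)
      refine (((hasDerivAt_id x).mul h1).add (h2.const_mul (1 - q))).congr_deriv ?_
      have h3 := psi_recurrence (q - 1) x
      rw [show q - 1 - 1 = q - 2 by ring, show q - 1 - 2 = q - 3 by ring] at h3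
      rw [show q - 1 - 1 = q - 2 by ring, show q - 2 - 1 = q - 3 by ring]
      simp only [id]
      linear_combination (1 - q) * h3
  obtain ⟨n, hn⟩ := exists_nat_gt q
  exact main n q hn

lemma continuous_psi (q : ℝ) : Continuous (psi q) :=
  continuous_iff_continuousAt.2 fun x => (hasDerivAt_psi q x).continuousAt

lemma tendsto_psi_div_rpow (q : ℝ) :
    Tendsto (fun z => psi q z / z ^ q) atTop (nhds 1) := by
  have inv2 : Tendsto (fun z : ℝ => (z ^ 2)⁻¹) atTop (nhds 0) :=
    tendsto_inv_atTop_zero.comp (tendsto_pow_atTop (by norm_num))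
  have main : ∀ n : ℕ, ∀ q : ℝ, q < n → Tendsto (fun z => psi q z / z ^ q) atTop (nhds 1) := by
    intro n
    induction n with
    | zero =>
      intro q hq
      have hq : q < 0 := by simpa using hq
      obtain ⟨a, rfl⟩ : ∃ a, q = -a := ⟨-q, by ring⟩
      have ha : 0 < a := by linarith
      have hG := Real.Gamma_pos_of_pos ha
      have hl : Tendsto (fun z : ℝ =>
          1 - (Real.Gamma (a + 2) / Real.Gamma a / 2) * (z ^ 2)⁻¹) atTop (nhds 1) := by
        simpa using (inv2.const_mul (Real.Gamma (a + 2) / Real.Gamma a / 2)).const_sub 1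
      refine tendsto_of_tendsto_of_tendsto_of_le_of_le' hl tendsto_const_nhds ?_ ?_
      · filter_upwards [eventually_gt_atTop 0] with z hz
        have h := le_gaussLaplace ha hz
        have e : z ^ (-(a + 2)) = z ^ (-a) * (z ^ 2)⁻¹ := by
          rw [show -(a + 2) = -a + (-2 : ℝ) by ring, Real.rpow_add hz, Real.rpow_neg hz.le]
          norm_num
        rw [e] at h
        have hz' : 0 < z ^ (-a) := by positivity
        rw [psi_of_neg hq, neg_neg, le_div_iff₀ hz']
        refine le_trans (le_of_eq ?_) (mul_le_mul_of_nonneg_left h (inv_nonneg.2 hG.le))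
        field_simp
      · filter_upwards [eventually_gt_atTop 0] with z hz
        have h := gaussLaplace_le ha hz
        have hz' : 0 < z ^ (-a) := by positivity
        rw [psi_of_neg hq, neg_neg, div_le_one hz', inv_mul_le_iff₀ hG]
        linarith
    | succ n ih =>
      intro q hq
      push_cast at hq
      have h1 := ih (q - 1) (by linarith)
      have h2 := ih (q - 2) (by linarith)
      have h := h1.add ((h2.mul inv2).const_mul (1 - q))
      simp only [mul_zero, add_zero] at h
      refine h.congr' ?_
      filter_upwards [eventually_gt_atTop 0] with z hz
      have e1 : z ^ (q - 1) = z ^ q / z := by rw [Real.rpow_sub hz, Real.rpow_one]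
      have e2 : z ^ (q - 2) = z ^ q / z ^ 2 := by
        rw [Real.rpow_sub hz]; norm_num
      have hz' : 0 < z ^ q := by positivity
      rw [psi_recurrence q z, e1, e2]
      field_simp
  obtain ⟨n, hn⟩ := exists_nat_gt q
  exact main n q hn

lemma exists_abs_psi_le (q : ℝ) {κ : ℝ} (hκ : 0 < κ) :
    ∃ K : ℝ, 1 ≤ K ∧ ∀ z, κ ≤ z → |psi q z| ≤ K * z ^ q := by
  obtain ⟨Z, hZ⟩ := eventually_atTop.1
    ((tendsto_psi_div_rpow q).abs.eventually (eventually_le_nhds (b := 2) (by norm_num)))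
  have hc : ContinuousOn (fun z => psi q z / z ^ q) (Set.Icc κ Z) := by
    intro z hz
    have hz0 : 0 < z := hκ.trans_le hz.1
    exact ((continuous_psi q).continuousAt.div
      (Real.continuousAt_rpow_const _ _ (Or.inl hz0.ne')) (by positivity)).continuousWithinAt
  obtain ⟨K, hK⟩ := isCompact_Icc.exists_bound_of_continuousOn hc
  refine ⟨max K 2, le_max_of_le_right (by norm_num), fun z hz => ?_⟩
  have hz0 : 0 < z := hκ.trans_le hz
  have hzq : 0 < z ^ q := by positivity
  have : |psi q z / z ^ q| ≤ max K 2 := by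
    by_cases h : z ≤ Z
    · exact (hK z ⟨hz, h⟩).trans (le_max_left _ _)
    · exact (hZ z (not_le.1 h).le).trans (le_max_right _ _)
  rwa [abs_div, abs_of_pos hzq, div_le_iff₀ hzq] at this

lemma psi_zero (x : ℝ) : psi 0 x = 1 := by
  have hconst : ∀ y, psi 0 y = psi 0 x := fun y =>
    is_const_of_deriv_eq_zero (fun z => (hasDerivAt_psi 0 z).differentiableAt)
      (fun z => by rw [(hasDerivAt_psi 0 z).deriv, zero_mul]) y x
  have h := tendsto_psi_div_rpow 0
  simp only [Real.rpow_zero, div_one, hconst] at h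
  exact tendsto_nhds_unique tendsto_const_nhds h

lemma psi_pos_of_nonpos {q : ℝ} (hq : q ≤ 0) (x : ℝ) : 0 < psi q x := by
  rcases hq.lt_or_eq with h | rfl
  · rw [psi_of_neg h]
    exact mul_pos (inv_pos.2 (Real.Gamma_pos_of_pos (by linarith))) (gaussLaplace_pos (by linarith) x)
  · rw [psi_zero]; exact one_pos

lemma eventually_psi_pos (q : ℝ) : ∀ᶠ z in atTop, 0 < psi q z := by
  filter_upwards [(tendsto_psi_div_rpow q).eventually (eventually_gt_nhds one_pos),
    eventually_gt_atTop 0] with z hz hz0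
  exact (div_pos_iff_of_pos_right (by positivity)).1 hz

lemma bddAbove_psi_zeros (q : ℝ) : BddAbove {x : ℝ | psi q x = 0} := by
  obtain ⟨Z, hZ⟩ := eventually_atTop.1 (eventually_psi_pos q)
  refine ⟨Z, fun x hx => ?_⟩
  by_contra h
  exact (hZ x (not_le.1 h).le).ne' hx

lemma psi_pos_of_cRoot_lt {q z : ℝ} (hz : cRoot q < z) : 0 < psi q z := by
  by_contra! h
  obtain ⟨Z, hZ⟩ := eventually_atTop.1 (eventually_psi_pos q)
  obtain ⟨w, hw, hw0⟩ := intermediate_value_Icc (le_max_left z Z)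
    (continuous_psi q).continuousOn ⟨h, (hZ (max z Z) (le_max_right _ _)).le⟩
  exact absurd (le_csSup (bddAbove_psi_zeros q) hw0) (not_le.2 (hz.trans_le hw.1))

lemma le_cRoot_of_psi_nonpos {q z : ℝ} (hz : psi q z ≤ 0) : z ≤ cRoot q := by
  by_contra! h
  exact (psi_pos_of_cRoot_lt h).not_ge hz

lemma psi_cRoot {q z : ℝ} (hz : psi q z ≤ 0) : psi q (cRoot q) = 0 := by
  obtain ⟨Z, hZ⟩ := eventually_atTop.1 (eventually_psi_pos q)
  obtain ⟨w, _, hw0⟩ := intermediate_value_Icc (le_max_left z Z)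
    (continuous_psi q).continuousOn ⟨hz, (hZ (max z Z) (le_max_right _ _)).le⟩
  exact (isClosed_eq (continuous_psi q) continuous_const).csSup_mem ⟨w, hw0⟩
    (bddAbove_psi_zeros q)

lemma psi_nonpos_of_cRoot_sub_one {q z : ℝ} (hz : psi (q - 1) z ≤ 0) :
    psi q (cRoot (q - 1)) ≤ 0 := by
  have h0 := psi_cRoot hz
  have hd : 0 ≤ (q - 1) * psi (q - 2) (cRoot (q - 1)) := by
    have hder := hasDerivAt_psi (q - 1) (cRoot (q - 1))
    rw [show q - 1 - 1 = q - 2 by ring] at hder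
    have hs := (hasDerivAt_iff_tendsto_slope.1 hder).mono_left
      (nhdsWithin_mono _ (fun x (hx : x ∈ Set.Ioi (cRoot (q - 1))) => (ne_of_gt hx)))
    refine ge_of_tendsto hs ?_
    filter_upwards [self_mem_nhdsWithin] with w hw
    have hw : cRoot (q - 1) < w := hw
    rw [slope_def_field, h0, sub_zero]
    exact div_nonneg (psi_pos_of_cRoot_lt hw).le (sub_pos.2 hw).le
  rw [psi_recurrence, h0]
  linarith

lemma exists_pos_psi_nonpos {q : ℝ} (hq : 1 < q) : ∃ z, 0 < z ∧ psi q z ≤ 0 := by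
  have main : ∀ n : ℕ, ∀ q : ℝ, 1 < q → q ≤ n + 2 → ∃ z, 0 < z ∧ psi q z ≤ 0 := by
    intro n
    induction n with
    | zero =>
      intro q hq hq2
      simp only [Nat.cast_zero, zero_add] at hq2
      have h0 : psi q 0 < 0 := by
        rw [psi_recurrence]
        have := psi_pos_of_nonpos (q := q - 2) (by linarith) 0
        nlinarith
      have hev := (continuous_psi q).continuousAt.eventually (eventually_lt_nhds h0)
      obtain ⟨z, hz, hz0⟩ := ((hev.filter_mono nhdsWithin_le_nhds).and
        (self_mem_nhdsWithin (s := Set.Ioi (0 : ℝ)))).exists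
      exact ⟨z, hz0, hz.le⟩
    | succ n ih =>
      intro q hq hq2
      push_cast at hq2
      by_cases h : q ≤ n + 2
      · exact ih q hq h
      obtain ⟨z, hz0, hz⟩ := ih (q - 1) (by
        have : (0 : ℝ) ≤ n := n.cast_nonneg
        linarith [not_le.1 h]) (by linarith)
      exact ⟨cRoot (q - 1), hz0.trans_le (le_cRoot_of_psi_nonpos hz),
        psi_nonpos_of_cRoot_sub_one hz⟩
  obtain ⟨n, hn⟩ := exists_nat_ge q
  exact main n q hq (by linarith)

lemma cRoot_pos {q : ℝ} (hq : 1 < q) : 0 < cRoot q := by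
  obtain ⟨z, hz0, hz⟩ := exists_pos_psi_nonpos hq
  exact hz0.trans_le (le_cRoot_of_psi_nonpos hz)

lemma exists_le_psi {q κ : ℝ} (hκ0 : 0 < κ) (hκ : cRoot q < κ) :
    ∃ a : ℝ, 0 < a ∧ a ≤ 1 ∧ ∀ z, κ ≤ z → a * z ^ q ≤ psi q z := by
  obtain ⟨Z, hZ⟩ := eventually_atTop.1
    ((tendsto_psi_div_rpow q).eventually (eventually_ge_nhds (b := 1 / 2) (by norm_num)))
  have hc : ContinuousOn (fun z => psi q z / z ^ q) (Set.Icc κ (max κ Z)) := by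
    intro z hz
    have hz0 : 0 < z := hκ0.trans_le hz.1
    exact ((continuous_psi q).continuousAt.div
      (Real.continuousAt_rpow_const _ _ (Or.inl hz0.ne')) (by positivity)).continuousWithinAt
  obtain ⟨w, hw, hmin⟩ := isCompact_Icc.exists_isMinOn
    (Set.nonempty_Icc.2 (le_max_left κ Z)) hc
  have hw0 : 0 < w := hκ0.trans_le hw.1
  refine ⟨min (psi q w / w ^ q) (1 / 2), lt_min (div_pos
    (psi_pos_of_cRoot_lt (hκ.trans_le hw.1)) (by positivity)) (by norm_num),
    (min_le_right _ _).trans (by norm_num), fun z hz => ?_⟩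
  have hz0 : 0 < z := hκ0.trans_le hz
  rw [← le_div_iff₀ (by positivity)]
  by_cases h : z ≤ max κ Z
  · exact (min_le_left _ _).trans (hmin ⟨hz, h⟩)
  · exact (min_le_right _ _).trans (hZ z ((le_max_right _ _).trans (not_le.1 h).le))

lemma V_zero_right (q x : ℝ) : V q x 0 = x ^ q := if_pos rfl

lemma V_of_pos {t : ℝ} (ht : 0 < t) (q x : ℝ) :
    V q x t = t ^ (q / 2) * psi q (x / Real.sqrt t) := if_neg ht.ne'

lemma rpow_half_eq_sqrt_rpow {t : ℝ} (ht : 0 ≤ t) (q : ℝ) : t ^ (q / 2) = Real.sqrt t ^ q := by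
  rw [Real.sqrt_eq_rpow, ← Real.rpow_mul ht]; ring_nf

lemma rpow_half_mul_div_sqrt_rpow {t y : ℝ} (ht : 0 < t) (hy : 0 < y) (q : ℝ) :
    t ^ (q / 2) * (y / Real.sqrt t) ^ q = y ^ q := by
  have hs := Real.sqrt_pos.2 ht
  rw [rpow_half_eq_sqrt_rpow ht.le, ← Real.mul_rpow hs.le (by positivity), mul_div_cancel₀ _ hs.ne']

lemma exists_abs_V_le (q : ℝ) {κ : ℝ} (hκ : 0 < κ) :
    ∃ K : ℝ, 1 ≤ K ∧ ∀ t y, 0 ≤ t → 0 < y → κ * Real.sqrt t ≤ y → |V q y t| ≤ K * y ^ q := by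
  obtain ⟨K, hK1, hK⟩ := exists_abs_psi_le q hκ
  refine ⟨K, hK1, fun t y ht hy hty => ?_⟩
  rcases ht.eq_or_lt with rfl | ht
  · have : 0 < y ^ q := by positivity
    rw [V_zero_right, abs_of_pos this]
    nlinarith
  · have h := hK (y / Real.sqrt t) ((le_div_iff₀ (Real.sqrt_pos.2 ht)).2 hty)
    rw [V_of_pos ht, abs_mul, abs_of_pos (by positivity), ← rpow_half_mul_div_sqrt_rpow ht hy]
    nlinarith [mul_le_mul_of_nonneg_left h (by positivity : 0 ≤ t ^ (q / 2))]

lemma exists_le_V {q κ : ℝ} (hκ0 : 0 < κ) (hκ : cRoot q < κ) :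
    ∃ a : ℝ, 0 < a ∧ a ≤ 1 ∧
      ∀ t y, 0 ≤ t → 0 < y → κ * Real.sqrt t ≤ y → a * y ^ q ≤ V q y t := by
  obtain ⟨a, ha0, ha1, ha⟩ := exists_le_psi hκ0 hκ
  refine ⟨a, ha0, ha1, fun t y ht hy hty => ?_⟩
  rcases ht.eq_or_lt with rfl | ht
  · have : 0 < y ^ q := by positivity
    rw [V_zero_right]
    nlinarith
  · have h := ha (y / Real.sqrt t) ((le_div_iff₀ (Real.sqrt_pos.2 ht)).2 hty)
    rw [V_of_pos ht, ← rpow_half_mul_div_sqrt_rpow ht hy]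
    nlinarith [mul_le_mul_of_nonneg_left h (by positivity : 0 ≤ t ^ (q / 2))]

lemma hasDerivAt_V_space (q : ℝ) {t y : ℝ} (ht : 0 ≤ t) (hy : 0 < y) :
    HasDerivAt (fun y => V q y t) (q * V (q - 1) y t) y := by
  rcases ht.eq_or_lt with rfl | ht
  · simp only [V_zero_right]
    exact Real.hasDerivAt_rpow_const (Or.inl hy.ne')
  · simp only [V_of_pos ht]
    have h1 : HasDerivAt (fun y : ℝ => y / Real.sqrt t) (1 / Real.sqrt t) y :=
      (hasDerivAt_id y).div_const _
    refine (((hasDerivAt_psi q (y / Real.sqrt t)).comp y h1).const_mul (t ^ (q / 2))).congr_deriv ?_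
    have hs := Real.sqrt_pos.2 ht
    rw [rpow_half_eq_sqrt_rpow ht.le, rpow_half_eq_sqrt_rpow ht.le, Real.rpow_sub_one hs.ne']
    field_simp

lemma hasDerivAt_V_time (q x : ℝ) {t : ℝ} (ht : 0 < t) :
    HasDerivAt (fun t => V q x t) (-(q * (q - 1) / 2) * V (q - 2) x t) t := by
  have hs := Real.sqrt_pos.2 ht
  have h1 : HasDerivAt (fun t : ℝ => x / Real.sqrt t)
      ((0 * Real.sqrt t - x * (1 / (2 * Real.sqrt t))) / Real.sqrt t ^ 2) t :=
    (hasDerivAt_const t x).div (Real.hasDerivAt_sqrt ht.ne') hs.ne'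
  have h2 := (Real.hasDerivAt_rpow_const (p := q / 2) (Or.inl ht.ne')).mul
    ((hasDerivAt_psi q (x / Real.sqrt t)).comp t h1)
  have h3 : (fun t => V q x t) =ᶠ[nhds t] fun t => t ^ (q / 2) * psi q (x / Real.sqrt t) := by
    filter_upwards [eventually_gt_nhds ht] with u hu
    exact V_of_pos hu q x
  refine (h2.congr_of_eventuallyEq h3).congr_deriv ?_
  have e1 : t ^ ((q - 2) / 2) = t ^ (q / 2) / t := by
    rw [show (q - 2) / 2 = q / 2 - 1 by ring, Real.rpow_sub_one ht.ne']
  have h4 := psi_recurrence q (x / Real.sqrt t)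
  have h5 : Real.sqrt t ^ 2 = t := Real.sq_sqrt ht.le
  simp only [Function.comp]
  rw [V_of_pos ht, e1, Real.rpow_sub_one ht.ne', h4]
  generalize Real.sqrt t = r at *
  subst h5
  field_simp
  ring

lemma continuousOn_V_time (q : ℝ) {y : ℝ} (hy : 0 < y) :
    ContinuousOn (fun t => V q y t) (Set.Ici 0) := by
  intro t ht
  rcases (Set.mem_Ici.1 ht).eq_or_lt with rfl | ht
  · rw [← continuousWithinAt_Ioi_iff_Ici, ContinuousWithinAt, V_zero_right]
    have h1 : Tendsto (fun t : ℝ => y / Real.sqrt t) (nhdsWithin 0 (Set.Ioi 0)) atTop := by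
      have h2 : Tendsto Real.sqrt (nhdsWithin 0 (Set.Ioi 0)) (nhdsWithin 0 (Set.Ioi 0)) := by
        refine tendsto_nhdsWithin_iff.2 ⟨?_, ?_⟩
        · have := (Real.continuous_sqrt.tendsto 0).mono_left
            (nhdsWithin_le_nhds (s := Set.Ioi 0))
          rwa [Real.sqrt_zero] at this
        · filter_upwards [self_mem_nhdsWithin] with u hu
          exact Real.sqrt_pos.2 hu
      simpa only [div_eq_mul_inv, Function.comp_def] using
        (tendsto_inv_nhdsGT_zero.comp h2).const_mul_atTop hy
    have h2 := ((tendsto_psi_div_rpow q).comp h1).const_mul (y ^ q)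
    rw [mul_one] at h2
    refine h2.congr' ?_
    filter_upwards [self_mem_nhdsWithin] with u hu
    have hu : 0 < u := hu
    have hs := Real.sqrt_pos.2 hu
    have hz : 0 < (y / Real.sqrt u) ^ q := by positivity
    simp only [Function.comp]
    rw [V_of_pos hu, ← rpow_half_mul_div_sqrt_rpow hu hy]
    field_simp
  · exact (hasDerivAt_V_time q y ht).continuousAt.continuousWithinAt

lemma exists_V_time_increment_le (q : ℝ) {κ : ℝ} (hκ : 0 < κ) :
    ∃ K : ℝ, 0 ≤ K ∧ ∀ t y, 0 ≤ t → 0 < y → κ * Real.sqrt (t + 1) ≤ y →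
      V q y (t + 1) + q * (q - 1) / 2 * V (q - 2) y (t + 1) ≤ V q y t + K * y ^ (q - 4) := by
  obtain ⟨K, hK1, hK⟩ := exists_abs_V_le (q - 4) hκ
  refine ⟨|q * (q - 1) / 2 * ((q - 2) * (q - 3) / 2)| * K, by positivity,
    fun t y ht hy hty => ?_⟩
  obtain ⟨u, hu, hu'⟩ := exists_hasDerivAt_eq_slope (fun t => V q y t)
    (fun t => -(q * (q - 1) / 2) * V (q - 2) y t) (lt_add_one t)
    ((continuousOn_V_time q hy).mono fun v hv => ht.trans hv.1)
    (fun v hv => hasDerivAt_V_time q y (ht.trans_lt hv.1))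
  have hu0 : 0 < u := ht.trans_lt hu.1
  obtain ⟨v, hv, hv'⟩ := exists_hasDerivAt_eq_slope (fun t => V (q - 2) y t)
    (fun t => -((q - 2) * (q - 2 - 1) / 2) * V (q - 2 - 2) y t) hu.2
    ((continuousOn_V_time (q - 2) hy).mono fun v hv => hu0.le.trans hv.1)
    (fun v hv => hasDerivAt_V_time (q - 2) y (hu0.trans hv.1))
  have hv0 : 0 < v := hu0.trans hv.1
  rw [show t + 1 - t = 1 by ring, div_one] at hu'
  rw [eq_div_iff (by linarith [hu.2]), show q - 2 - 1 = q - 3 by ring,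
    show q - 2 - 2 = q - 4 by ring] at hv'
  have hb := hK v y hv0.le hy
    ((mul_le_mul_of_nonneg_left (Real.sqrt_le_sqrt hv.2.le) hκ.le).trans hty)
  have e : V q y (t + 1) + q * (q - 1) / 2 * V (q - 2) y (t + 1) - V q y t
      = -((q * (q - 1) / 2 * ((q - 2) * (q - 3) / 2)) * V (q - 4) y v) * (t + 1 - u) := by
    linear_combination -hu' - q * (q - 1) / 2 * hv'
  have h1 : |V q y (t + 1) + q * (q - 1) / 2 * V (q - 2) y (t + 1) - V q y t|
      ≤ |q * (q - 1) / 2 * ((q - 2) * (q - 3) / 2)| * (K * y ^ (q - 4)) * 1 := by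
    rw [e, abs_mul, abs_neg, abs_mul]
    have h2 : |t + 1 - u| ≤ 1 := by
      rw [abs_of_pos (by linarith [hu.2])]; linarith [hu.1]
    gcongr
  linarith [le_abs_self (V q y (t + 1) + q * (q - 1) / 2 * V (q - 2) y (t + 1) - V q y t)]

lemma abs_sub_taylor_two_le {f f₁ f₂ f₃ : ℝ → ℝ} {x r M : ℝ}
    (h₀ : ∀ u ∈ Set.Icc (x - r) (x + r), HasDerivAt f (f₁ u) u)
    (h₁ : ∀ u ∈ Set.Icc (x - r) (x + r), HasDerivAt f₁ (f₂ u) u)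
    (h₂ : ∀ u ∈ Set.Icc (x - r) (x + r), HasDerivAt f₂ (f₃ u) u)
    (h₃ : ∀ u ∈ Set.Icc (x - r) (x + r), |f₃ u| ≤ M) {y : ℝ}
    (hy : y ∈ Set.Icc (x - r) (x + r)) :
    |f y - f x - f₁ x * (y - x) - f₂ x / 2 * (y - x) ^ 2| ≤ M * r ^ 3 := by
  have hr : 0 ≤ r := by linarith [hy.1, hy.2]
  have hx : x ∈ Set.Icc (x - r) (x + r) := ⟨by linarith, by linarith⟩
  have hM : 0 ≤ M := (abs_nonneg _).trans (h₃ x hx)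
  have hd : ∀ u ∈ Set.Icc (x - r) (x + r), |u - x| ≤ r := fun u hu =>
    abs_le.2 ⟨by linarith [hu.1], by linarith [hu.2]⟩
  have step : ∀ {g g' : ℝ → ℝ} {N : ℝ}, 0 ≤ N → g x = 0 →
      (∀ u ∈ Set.Icc (x - r) (x + r), HasDerivAt g (g' u) u) →
      (∀ u ∈ Set.Icc (x - r) (x + r), |g' u| ≤ N) →
      ∀ u ∈ Set.Icc (x - r) (x + r), |g u| ≤ N * r := by
    intro g g' N hN hg hg1 hg2 u hu
    have h := (convex_Icc (x - r) (x + r)).norm_image_sub_le_of_norm_hasDerivWithin_le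
      (fun v hv => (hg1 v hv).hasDerivWithinAt) hg2 hx hu
    rw [hg, sub_zero] at h
    exact h.trans (mul_le_mul_of_nonneg_left (hd u hu) hN)
  have s2 := step (g := fun u => f₂ u - f₂ x) hM (by simp)
    (fun u hu => (h₂ u hu).sub_const _) h₃
  have s1 := step (g := fun u => f₁ u - f₁ x - f₂ x * (u - x)) (by positivity) (by simp)
    (fun u hu => by
      refine (((h₁ u hu).sub_const _).sub
        (((hasDerivAt_id u).sub_const x).const_mul (f₂ x))).congr_deriv ?_
      rw [mul_one]) s2
  have s0 := step (g := fun u => f u - f x - f₁ x * (u - x) - f₂ x / 2 * (u - x) ^ 2)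
    (by positivity) (by simp)
    (fun u hu => by
      refine ((((h₀ u hu).sub_const _).sub
        (((hasDerivAt_id u).sub_const x).const_mul (f₁ x))).sub
        ((((hasDerivAt_id u).sub_const x).pow 2).const_mul (f₂ x / 2))).congr_deriv ?_
      simp
      ring) s1 y hy
  calc _ ≤ M * r * r * r := s0
    _ = _ := by ring

lemma rpow_le_two_rpow_abs_mul {y w : ℝ} (r : ℝ) (hy : 0 < y) (h1 : y / 2 ≤ w) (h2 : w ≤ 2 * y) :
    w ^ r ≤ 2 ^ |r| * y ^ r := by
  have hw : 0 < w := by linarith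
  rcases le_total 0 r with hr | hr
  · rw [abs_of_nonneg hr, ← Real.mul_rpow (by norm_num) hy.le]
    exact Real.rpow_le_rpow hw.le h2 hr
  · rw [abs_of_nonpos hr]
    calc w ^ r ≤ (y / 2) ^ r := Real.rpow_le_rpow_of_nonpos (by linarith) h1 hr
      _ = _ := by
        rw [Real.div_rpow hy.le (by norm_num), Real.rpow_neg (by norm_num)]; ring

lemma exists_V_taylor (q : ℝ) {κ : ℝ} (hκ : 0 < κ) :
    ∃ K : ℝ, 0 < K ∧ ∀ t y s, 0 ≤ t → 0 < y → |s| ≤ y / 2 → κ * Real.sqrt t ≤ y - |s| →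
      |V q (y + s) t - V q y t - q * V (q - 1) y t * s
        - q * (q - 1) / 2 * V (q - 2) y t * s ^ 2| ≤ K * (y ^ (q - 3) * |s| ^ 3) := by
  obtain ⟨K, hK1, hK⟩ := exists_abs_V_le (q - 3) hκ
  refine ⟨|q * (q - 1) * (q - 2)| * (K * 2 ^ |q - 3|) + 1, by positivity,
    fun t y s ht hy hs hty => ?_⟩
  have hpos : ∀ u ∈ Set.Icc (y - |s|) (y + |s|), 0 < u := fun u hu => by linarith [hu.1]
  have key := abs_sub_taylor_two_le (f := fun u => V q u t)
    (f₁ := fun u => q * V (q - 1) u t) (f₂ := fun u => q * (q - 1) * V (q - 2) u t)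
    (f₃ := fun u => q * (q - 1) * (q - 2) * V (q - 3) u t) (x := y) (r := |s|)
    (M := |q * (q - 1) * (q - 2)| * (K * (2 ^ |q - 3| * y ^ (q - 3))))
    (fun u hu => hasDerivAt_V_space q ht (hpos u hu))
    (fun u hu => by
      refine ((hasDerivAt_V_space (q - 1) ht (hpos u hu)).const_mul q).congr_deriv ?_
      rw [show q - 1 - 1 = q - 2 by ring]; ring)
    (fun u hu => by
      refine ((hasDerivAt_V_space (q - 2) ht (hpos u hu)).const_mul _).congr_deriv ?_
      rw [show q - 2 - 1 = q - 3 by ring]; ring)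
    (fun u hu => by
      rw [abs_mul]
      have h1 := hK t u ht (hpos u hu) (hty.trans hu.1)
      have h2 := rpow_le_two_rpow_abs_mul (q - 3) hy (w := u)
        (by linarith [hu.1]) (by linarith [hu.2])
      exact mul_le_mul_of_nonneg_left (h1.trans (mul_le_mul_of_nonneg_left h2 (by linarith)))
        (abs_nonneg _))
    (y := y + s) ⟨by linarith [neg_abs_le s], by linarith [le_abs_self s]⟩
  rw [add_sub_cancel_left] at key
  calc _ = |V q (y + s) t - V q y t - q * V (q - 1) y t * s
        - q * (q - 1) * V (q - 2) y t / 2 * s ^ 2| := by congr 1; ring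
    _ ≤ _ := key
    _ = |q * (q - 1) * (q - 2)| * (K * 2 ^ |q - 3|) * (y ^ (q - 3) * |s| ^ 3) := by ring
    _ ≤ _ := by
      gcongr
      linarith

lemma exists_rpow_add_ge {q : ℝ} (hq : 1 < q) :
    ∃ ε : ℝ, 0 < ε ∧ ε ≤ 1 / 2 ∧ ∀ y s, 0 < y → |s| ≤ ε * y →
      y ^ q + q * y ^ (q - 1) * s + q * (q - 1) / 4 * y ^ (q - 2) * s ^ 2 ≤ (y + s) ^ q := by
  obtain ⟨K, hK0, hK⟩ := exists_V_taylor q one_pos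
  have hm : 0 < q * (q - 1) / 4 := by
    have : 0 < q - 1 := by linarith
    positivity
  refine ⟨min (1 / 2) (q * (q - 1) / 4 / K), lt_min (by norm_num) (by positivity),
    min_le_left _ _, fun y s hy hs => ?_⟩
  have hs1 : |s| ≤ y / 2 := hs.trans (by
    linarith [mul_le_mul_of_nonneg_right (min_le_left (1 / 2) (q * (q - 1) / 4 / K)) hy.le])
  have hs2 : K * |s| ≤ q * (q - 1) / 4 * y := by
    have h1 := hs.trans (mul_le_mul_of_nonneg_right (min_le_right (1 / 2) _) hy.le)
    have h2 := mul_le_mul_of_nonneg_left h1 hK0.le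
    calc K * |s| ≤ _ := h2
      _ = _ := by field_simp
  have h := hK 0 y s le_rfl hy hs1 (by rw [Real.sqrt_zero, mul_zero]; linarith)
  simp only [V_zero_right] at h
  have h3 : K * (y ^ (q - 3) * |s| ^ 3) ≤ q * (q - 1) / 4 * y ^ (q - 2) * s ^ 2 := by
    have e : y ^ (q - 2) = y ^ (q - 3) * y := by
      rw [← Real.rpow_add_one hy.ne']; ring_nf
    have h4 : 0 ≤ y ^ (q - 3) * |s| ^ 2 := by positivity
    rw [e, ← sq_abs s]
    nlinarith [mul_le_mul_of_nonneg_right hs2 h4]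
  have h5 := (abs_le.1 h).1
  linarith

lemma rpow_mul_rpow_le_of_le {p y w e j : ℝ} (hy : 0 < y) (hw : 0 ≤ w) (hwy : w ≤ y) (he : 0 < e)
    (hej : e ≤ j) : y ^ (p - j) * w ^ j ≤ y ^ (p - e) * w ^ e := by
  rcases hw.eq_or_lt with rfl | hw
  · rw [Real.zero_rpow (he.trans_le hej).ne', Real.zero_rpow he.ne', mul_zero, mul_zero]
  · have h : w ^ (j - e) ≤ y ^ (j - e) := Real.rpow_le_rpow hw.le hwy (by linarith)
    calc y ^ (p - j) * w ^ j = y ^ (p - j) * (w ^ (j - e) * w ^ e) := by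
          rw [← Real.rpow_add hw]; ring_nf
      _ ≤ y ^ (p - j) * (y ^ (j - e) * w ^ e) := by gcongr
      _ = _ := by rw [← mul_assoc, ← Real.rpow_add hy]; ring_nf

lemma rpow_mul_rpow_le_of_ge {p y w e j ε : ℝ} (hy : 0 < y) (hε : 0 < ε) (hε1 : ε ≤ 1)
    (hwy : ε * y ≤ w) (hj : 0 ≤ j) (hje : j ≤ e) :
    y ^ (p - j) * w ^ j ≤ ε ^ (-e) * (y ^ (p - e) * w ^ e) := by
  have hw : 0 < w := (mul_pos hε hy).trans_le hwy
  have h : y ^ (e - j) ≤ ε ^ (-e) * w ^ (e - j) := by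
    calc y ^ (e - j) ≤ (ε⁻¹ * w) ^ (e - j) := by
          refine Real.rpow_le_rpow hy.le ?_ (by linarith)
          rwa [le_inv_mul_iff₀ hε]
      _ = ε ^ (-(e - j)) * w ^ (e - j) := by
          rw [Real.mul_rpow (by positivity) hw.le, Real.inv_rpow hε.le, Real.rpow_neg hε.le]
      _ ≤ _ := by
          gcongr ?_ * _
          exact Real.rpow_le_rpow_of_exponent_ge hε hε1 (by linarith)
  calc y ^ (p - j) * w ^ j = y ^ (p - e) * (y ^ (e - j) * w ^ j) := by
        rw [← mul_assoc, ← Real.rpow_add hy]; ring_nf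
    _ ≤ y ^ (p - e) * (ε ^ (-e) * w ^ (e - j) * w ^ j) := by gcongr
    _ = _ := by
        rw [mul_assoc (ε ^ (-e)), ← Real.rpow_add hw]; ring_nf

/-- The quadratic-plus-tail majorant of the corrected function one step ahead of `(y, t)`. -/
def stepMajorant (p δ C m L t y s : ℝ) : ℝ :=
  V p y (t + 1) - C * y ^ (p - δ)
    + (p * V (p - 1) y (t + 1) - C * ((p - δ) * y ^ (p - δ - 1))) * s
    + (p * (p - 1) / 2 * V (p - 2) y (t + 1) - C * (m * y ^ (p - δ - 2))) * s ^ 2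
    + L * (y ^ (p - δ - 2) * (|s| ^ (2 + δ) + |s| ^ p))

lemma stepMajorant_mono {p δ C m L L' t y s : ℝ} (hy : 0 ≤ y) (hL : L ≤ L') :
    stepMajorant p δ C m L t y s ≤ stepMajorant p δ C m L' t y s := by
  unfold stepMajorant
  gcongr

lemma mul_sqrt_add_one_le {c κ R t x : ℝ} (hc : 0 ≤ c) (hcκ : c ≤ κ) (hR : κ ≤ R)
    (hx : κ * Real.sqrt t + R ≤ x) (ht : 0 ≤ t) : c * Real.sqrt (t + 1) ≤ x := by
  have h : Real.sqrt (t + 1) ≤ Real.sqrt t + 1 := by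
    rw [Real.sqrt_le_left (by positivity)]
    nlinarith [Real.sq_sqrt ht, Real.sqrt_nonneg t]
  nlinarith [mul_le_mul_of_nonneg_left h hc, mul_le_mul_of_nonneg_right hcκ (Real.sqrt_nonneg t)]

lemma exists_near_majorant {p δ γ : ℝ} (hp : 1 < p) (hδ0 : 0 < δ) (hδ1 : δ < 1)
    (hδp : δ < p - 1) (hγ : 0 < γ) :
    ∃ ε : ℝ, 0 < ε ∧ ε ≤ 1 / 2 ∧ ∃ L : ℝ, 0 ≤ L ∧ ∃ a : ℝ, 0 < a ∧ a ≤ 1 ∧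
      ∀ C R t y s, 0 < C → 0 < R → 2 * (cRoot p + γ) ≤ R → C ≤ a * (R / 2) ^ δ → 0 ≤ t →
        (cRoot p + γ) * Real.sqrt t + R ≤ y → |s| ≤ ε * y →
        max (Vbar p (y + s) (t + 1) - C * |y + s| ^ (p - δ)) 0
          ≤ stepMajorant p δ C ((p - δ) * (p - δ - 1) / 4) L t y s := by
  have hc := cRoot_pos hp
  obtain ⟨ε₀, hε₀, hε₀2, hpow⟩ := exists_rpow_add_ge (q := p - δ) (by linarith)
  obtain ⟨K, hK0, hK⟩ := exists_V_taylor p hc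
  obtain ⟨a, ha0, ha1, ha⟩ := exists_le_V (q := p) (κ := cRoot p + γ / 2) (by linarith)
    (by linarith)
  set c := cRoot p with hcdef
  refine ⟨min ε₀ (γ / (2 * (c + γ))), lt_min hε₀ (by positivity), (min_le_left _ _).trans hε₀2,
    K, hK0.le, a, ha0, ha1, fun C R t y s hC hR0 hR hCR ht hy hs => ?_⟩
  have hst := Real.sqrt_nonneg t
  have hyR : R ≤ y := by nlinarith [mul_nonneg (by linarith : 0 ≤ c + γ) hst]
  have hy0 : 0 < y := hR0.trans_le hyR
  have hs1 : |s| ≤ ε₀ * y := hs.trans (mul_le_mul_of_nonneg_right (min_le_left _ _) hy0.le)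
  have hs2 : |s| ≤ y / 2 := hs1.trans (by nlinarith)
  have hs3 : (c + γ) * |s| ≤ γ / 2 * y := by
    have h1 := hs.trans (mul_le_mul_of_nonneg_right (min_le_right ε₀ _) hy0.le)
    have h2 := mul_le_mul_of_nonneg_left h1 (by linarith : 0 ≤ c + γ)
    calc _ ≤ _ := h2
      _ = _ := by field_simp
  have hfar : (c + γ / 2) * Real.sqrt t + R / 2 ≤ y - |s| := by
    have h1 : (c + γ / 2) * y ≤ (c + γ) * (y - |s|) := by linarith
    have h2 : (c + γ) * ((c + γ / 2) * Real.sqrt t + R / 2) ≤ (c + γ / 2) * y := by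
      nlinarith [mul_le_mul_of_nonneg_left hy (by linarith : 0 ≤ c + γ / 2)]
    exact le_of_mul_le_mul_left (h2.trans h1) (by linarith)
  have hray : (c + γ / 2) * Real.sqrt (t + 1) ≤ y - |s| :=
    mul_sqrt_add_one_le (by linarith) le_rfl (by linarith) hfar ht
  have hst1 := Real.sqrt_nonneg (t + 1)
  have hray0 : c * Real.sqrt (t + 1) ≤ y - |s| :=
    (mul_le_mul_of_nonneg_right (by linarith) hst1).trans hray
  have hsy : y - |s| ≤ y + s := by linarith [neg_abs_le s]
  have hys : R / 2 ≤ y + s := by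
    nlinarith [mul_nonneg (by linarith : 0 ≤ c + γ / 2) hst]
  have hys0 : 0 < y + s := by linarith
  have hVbar : Vbar p (y + s) (t + 1) = V p (y + s) (t + 1) := if_pos (hray0.trans hsy)
  have hnonneg : 0 ≤ V p (y + s) (t + 1) - C * (y + s) ^ (p - δ) := by
    have h1 := ha (t + 1) (y + s) (by linarith) hys0 (hray.trans hsy)
    have h2 : C ≤ a * (y + s) ^ δ :=
      hCR.trans (mul_le_mul_of_nonneg_left (Real.rpow_le_rpow (by linarith) hys hδ0.le) ha0.le)
    have e : (y + s) ^ p = (y + s) ^ δ * (y + s) ^ (p - δ) := by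
      rw [← Real.rpow_add hys0]; ring_nf
    have h3 : 0 < (y + s) ^ (p - δ) := by positivity
    rw [e] at h1
    nlinarith [mul_le_mul_of_nonneg_right h2 h3.le]
  have hT := hK (t + 1) y s (by linarith) hy0 hs2 hray0
  have hP := mul_le_mul_of_nonneg_left (hpow y s hy0 hs1) hC.le
  have h3 : K * (y ^ (p - 3) * |s| ^ 3) ≤ K * (y ^ (p - δ - 2) * (|s| ^ (2 + δ) + |s| ^ p)) := by
    have h := rpow_mul_rpow_le_of_le (p := p) (e := 2 + δ) (j := 3) hy0 (abs_nonneg s)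
      (by linarith) (by linarith) (by linarith)
    rw [show p - (2 + δ) = p - δ - 2 by ring] at h
    have e3 : |s| ^ (3 : ℝ) = |s| ^ 3 := by norm_cast
    rw [e3] at h
    have h4 : 0 ≤ y ^ (p - δ - 2) * |s| ^ p := by positivity
    rw [mul_add]
    exact mul_le_mul_of_nonneg_left (by linarith) hK0.le
  rw [hVbar, abs_of_pos hys0, max_eq_left hnonneg]
  have h5 := (abs_le.1 hT).2
  unfold stepMajorant
  linarith

lemma exists_far_value_le {p δ ε : ℝ} (hp : 1 < p) (hε : 0 < ε) (hε1 : ε ≤ 1) :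
    ∃ L : ℝ, 0 ≤ L ∧ ∀ C t y s, 0 < C → 1 ≤ y → 0 ≤ t → ε * y ≤ |s| →
        max (Vbar p (y + s) (t + 1) - C * |y + s| ^ (p - δ)) 0
          ≤ L * (y ^ (p - δ - 2) * (|s| ^ (2 + δ) + |s| ^ p)) := by
  have hc := cRoot_pos hp
  obtain ⟨K₀, hK₀1, hK₀⟩ := exists_abs_V_le p hc
  set E := ε ^ (-(2 + δ)) with hE
  have hE0 : 0 < E := by positivity
  set Q := (1 / ε + 1) ^ p with hQ
  have hQ0 : 0 < Q := by positivity
  refine ⟨K₀ * Q * (E + 1), by positivity, fun C t y s hC hy1 ht hs => ?_⟩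
  have hy0 : 0 < y := by linarith
  have hw0 : 0 < |s| := (mul_pos hε hy0).trans_le hs
  have hleft : max (Vbar p (y + s) (t + 1) - C * |y + s| ^ (p - δ)) 0 ≤ K₀ * (Q * |s| ^ p) := by
    have hR : 0 ≤ K₀ * (Q * |s| ^ p) := by positivity
    refine max_le ?_ hR
    have hCn : 0 ≤ C * |y + s| ^ (p - δ) := by positivity
    suffices Vbar p (y + s) (t + 1) ≤ K₀ * (Q * |s| ^ p) by linarith
    unfold Vbar
    split_ifs with h
    · have hst : 0 < Real.sqrt (t + 1) := Real.sqrt_pos.2 (by linarith)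
      have hys : 0 < y + s := (mul_pos hc hst).trans_le h
      refine (le_abs_self _).trans ((hK₀ (t + 1) (y + s) (by linarith) hys h).trans ?_)
      rw [← Real.mul_rpow (by positivity) hw0.le]
      gcongr
      have : y ≤ 1 / ε * |s| := by rwa [one_div, le_inv_mul_iff₀ hε]
      linarith [le_abs_self s]
    · exact hR
  set T := y ^ (p - δ - 2) * |s| ^ (2 + δ) with hT
  have hT0 : 0 ≤ T := by positivity
  set T' := y ^ (p - δ - 2) * |s| ^ p with hT'
  have hT'0 : 0 ≤ T' := by positivity
  have hsp : |s| ^ p ≤ E * T + T' := by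
    rcases le_total p (2 + δ) with h | h
    · have h1 := rpow_mul_rpow_le_of_ge (p := p) hy0 hε hε1 hs (by linarith) h
      rw [show p - (2 + δ) = p - δ - 2 by ring, sub_self, Real.rpow_zero, one_mul] at h1
      linarith
    · have h1 : 1 ≤ y ^ (p - δ - 2) := Real.one_le_rpow hy1 (by linarith)
      have h2 : 0 ≤ |s| ^ p := by positivity
      nlinarith [mul_nonneg hE0.le hT0]
  rw [mul_add (y ^ (p - δ - 2)), mul_assoc]
  rw [← mul_assoc] at hleft
  refine hleft.trans ?_
  refine mul_le_mul_of_nonneg_left (hsp.trans ?_) (by positivity)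
  rw [add_mul, one_mul, mul_add]
  linarith [mul_nonneg hE0.le hT'0]

lemma exists_stepMajorant_nonneg {p δ ε m : ℝ} (hp : 1 < p) (hδ0 : 0 < δ) (hδp : δ < p - 1)
    (hm0 : 0 ≤ m) (hε : 0 < ε) (hε1 : ε ≤ 1) :
    ∃ L : ℝ, 0 ≤ L ∧ ∀ C t y s, 0 < C → 0 < y → C ≤ y ^ δ → 0 ≤ t →
        cRoot p * Real.sqrt (t + 1) ≤ y → ε * y ≤ |s| → 0 ≤ stepMajorant p δ C m L t y s := by
  have hc := cRoot_pos hp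
  obtain ⟨K₀, hK₀1, hK₀⟩ := exists_abs_V_le p hc
  obtain ⟨K₁, hK₁1, hK₁⟩ := exists_abs_V_le (p - 1) hc
  obtain ⟨K₂, hK₂1, hK₂⟩ := exists_abs_V_le (p - 2) hc
  have hp2 : 0 ≤ p * (p - 1) / 2 := by
    have : 0 < p - 1 := by linarith
    positivity
  have hpδ : 0 ≤ p - δ := by linarith
  set E := ε ^ (-(2 + δ)) with hE
  have hE0 : 0 < E := by positivity
  refine ⟨E * (K₀ + 1 + (p * K₁ + (p - δ)) + (p * (p - 1) / 2 * K₂ + m)),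
    by positivity, fun C t y s hC hy0 hCy ht hty hs => ?_⟩
  have hw0 : 0 < |s| := (mul_pos hε hy0).trans_le hs
  set T := y ^ (p - δ - 2) * |s| ^ (2 + δ) with hT
  have hT0 : 0 ≤ T := by positivity
  set T' := y ^ (p - δ - 2) * |s| ^ p with hT'
  have hT'0 : 0 ≤ T' := by positivity
  have compare : ∀ j : ℝ, 0 ≤ j → j ≤ 2 + δ → y ^ (p - j) * |s| ^ j ≤ E * T := by
    intro j hj hj2
    have h := rpow_mul_rpow_le_of_ge (p := p) hy0 hε hε1 hs hj hj2
    rwa [show p - (2 + δ) = p - δ - 2 by ring] at h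
  have hCpow : ∀ r : ℝ, C * y ^ (r - δ) ≤ y ^ r := by
    intro r
    calc C * y ^ (r - δ) ≤ y ^ δ * y ^ (r - δ) := by gcongr
      _ = y ^ r := by rw [← Real.rpow_add hy0]; ring_nf
  have hA : -((K₀ + 1) * (E * T)) ≤ V p y (t + 1) - C * y ^ (p - δ) := by
    have h1 := (abs_le.1 (hK₀ (t + 1) y (by linarith) hy0 hty)).1
    have h2 := compare 0 le_rfl (by linarith)
    rw [sub_zero, Real.rpow_zero, mul_one] at h2
    have h3 := mul_le_mul_of_nonneg_left h2 (by linarith : 0 ≤ K₀ + 1)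
    linarith [hCpow p]
  have hB : -((p * K₁ + (p - δ)) * (E * T))
      ≤ (p * V (p - 1) y (t + 1) - C * ((p - δ) * y ^ (p - δ - 1))) * s := by
    have h1 := hK₁ (t + 1) y (by linarith) hy0 hty
    have h2 := compare 1 zero_le_one (by linarith)
    rw [Real.rpow_one] at h2
    have h4 := hCpow (p - 1)
    rw [show p - 1 - δ = p - δ - 1 by ring] at h4
    have h5 : |p * V (p - 1) y (t + 1) - C * ((p - δ) * y ^ (p - δ - 1))|
        ≤ (p * K₁ + (p - δ)) * y ^ (p - 1) := by
      refine (abs_sub _ _).trans ?_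
      rw [abs_mul p, abs_of_pos (by linarith : 0 < p),
        abs_of_nonneg (by positivity : 0 ≤ C * ((p - δ) * y ^ (p - δ - 1)))]
      nlinarith [mul_le_mul_of_nonneg_left h1 (by linarith : 0 ≤ p),
        mul_le_mul_of_nonneg_left h4 hpδ]
    refine (neg_le_neg ?_).trans (neg_abs_le _)
    rw [abs_mul]
    calc _ ≤ (p * K₁ + (p - δ)) * y ^ (p - 1) * |s| := by gcongr
      _ = (p * K₁ + (p - δ)) * (y ^ (p - 1) * |s|) := by ring
      _ ≤ _ := by gcongr
  have hD : -((p * (p - 1) / 2 * K₂ + m) * (E * T))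
      ≤ (p * (p - 1) / 2 * V (p - 2) y (t + 1) - C * (m * y ^ (p - δ - 2))) * s ^ 2 := by
    have h1 := (abs_le.1 (hK₂ (t + 1) y (by linarith) hy0 hty)).1
    have h2 := compare 2 (by norm_num) (by linarith)
    have e2 : |s| ^ (2 : ℝ) = s ^ 2 := by rw [← sq_abs s]; norm_cast
    rw [e2] at h2
    have h4 := hCpow (p - 2)
    rw [show p - 2 - δ = p - δ - 2 by ring] at h4
    have h5 : -((p * (p - 1) / 2 * K₂ + m) * y ^ (p - 2))
        ≤ p * (p - 1) / 2 * V (p - 2) y (t + 1) - C * (m * y ^ (p - δ - 2)) := by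
      nlinarith [mul_le_mul_of_nonneg_left h1 hp2, mul_le_mul_of_nonneg_left h4 hm0]
    refine le_trans ?_ (mul_le_mul_of_nonneg_right h5 (sq_nonneg s))
    have h6 := mul_le_mul_of_nonneg_left h2 (by positivity : 0 ≤ p * (p - 1) / 2 * K₂ + m)
    linarith
  unfold stepMajorant
  rw [mul_add (y ^ (p - δ - 2)), ← hT, ← hT']
  set k₀ := K₀ + 1
  set k₁ := p * K₁ + (p - δ)
  set k₂ := p * (p - 1) / 2 * K₂ + m
  calc 0 ≤ E * (k₀ + k₁ + k₂) * T' := by positivity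
    _ = -(k₀ * (E * T)) + -(k₁ * (E * T)) + -(k₂ * (E * T))
        + E * (k₀ + k₁ + k₂) * (T + T') := by ring
    _ ≤ _ := add_le_add_left (add_le_add (add_le_add hA hB) hD) _

lemma exists_far_majorant {p δ ε m : ℝ} (hp : 1 < p) (hδ0 : 0 < δ) (hδp : δ < p - 1)
    (hm0 : 0 ≤ m) (hε : 0 < ε) (hε1 : ε ≤ 1) :
    ∃ L : ℝ, 0 ≤ L ∧ ∀ C t y s, 0 < C → 1 ≤ y → C ≤ y ^ δ → 0 ≤ t →
        cRoot p * Real.sqrt (t + 1) ≤ y → ε * y ≤ |s| →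
        max (Vbar p (y + s) (t + 1) - C * |y + s| ^ (p - δ)) 0
          ≤ stepMajorant p δ C m L t y s := by
  obtain ⟨L₁, hL₁, h₁⟩ := exists_far_value_le (δ := δ) hp hε hε1
  obtain ⟨L₂, hL₂, h₂⟩ := exists_stepMajorant_nonneg hp hδ0 hδp hm0 hε hε1
  refine ⟨L₁ + L₂, by positivity, fun C t y s hC hy1 hCy ht hty hs => ?_⟩
  have h3 := h₁ C t y s hC hy1 ht hs
  have h4 := h₂ C t y s hC (by linarith) hCy ht hty hs
  unfold stepMajorant at h4 ⊢
  rw [add_mul L₁]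
  linarith

lemma exists_step_majorant {p δ γ : ℝ} (hp : 1 < p) (hδ0 : 0 < δ) (hδ1 : δ < 1)
    (hδp : δ < p - 1) (hγ : 0 < γ) :
    ∃ L : ℝ, 0 ≤ L ∧ ∀ C, 0 < C → ∃ R : ℝ, 1 ≤ R ∧ cRoot p + γ ≤ R ∧
      ∀ t y s, 0 ≤ t → (cRoot p + γ) * Real.sqrt t + R ≤ y →
        max (Vbar p (y + s) (t + 1) - C * |y + s| ^ (p - δ)) 0
          ≤ stepMajorant p δ C ((p - δ) * (p - δ - 1) / 4) L t y s := by
  have hc := cRoot_pos hp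
  obtain ⟨ε, hε0, hε2, L₁, _, a, ha0, ha1, hnear⟩ := exists_near_majorant hp hδ0 hδ1 hδp hγ
  obtain ⟨L₂, hL₂, hfar⟩ := exists_far_majorant (m := (p - δ) * (p - δ - 1) / 4) hp hδ0 hδp
    (div_nonneg (mul_nonneg (by linarith) (by linarith)) (by norm_num)) hε0 (by linarith)
  refine ⟨max L₁ L₂, le_max_of_le_right hL₂, fun C hC => ?_⟩
  have hr : 0 < (C / a) ^ (1 / δ) := by positivity
  refine ⟨1 + 2 * (cRoot p + γ) + 2 * (C / a) ^ (1 / δ), by linarith, by linarith,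
    fun t y s ht hy => ?_⟩
  set R := 1 + 2 * (cRoot p + γ) + 2 * (C / a) ^ (1 / δ) with hRdef
  have hCR : C ≤ a * (R / 2) ^ δ := by
    have h1 : ((C / a) ^ (1 / δ)) ^ δ ≤ (R / 2) ^ δ :=
      Real.rpow_le_rpow hr.le (by linarith) hδ0.le
    rw [← Real.rpow_mul (by positivity), one_div, inv_mul_cancel₀ hδ0.ne', Real.rpow_one,
      div_le_iff₀ ha0] at h1
    linarith
  have hyR : R ≤ y := by
    nlinarith [mul_nonneg (by linarith : 0 ≤ cRoot p + γ) (Real.sqrt_nonneg t)]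
  have hy1 : 1 ≤ y := by linarith
  rcases le_total |s| (ε * y) with hs | hs
  · exact (hnear C R t y s hC (by linarith) (by linarith) hCR ht hy hs).trans
      (stepMajorant_mono (by linarith) (le_max_left _ _))
  · have hCy : C ≤ y ^ δ := by
      have h1 : (R / 2) ^ δ ≤ y ^ δ := Real.rpow_le_rpow (by linarith) (by linarith) hδ0.le
      have h2 : 0 ≤ (R / 2) ^ δ := Real.rpow_nonneg (by linarith) _
      nlinarith
    exact (hfar C t y s hC hy1 hCy ht
      (mul_sqrt_add_one_le hc.le (by linarith) (by linarith) hy ht) hs).trans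
      (stepMajorant_mono (by linarith) (le_max_right _ _))

/-- Lemma 8: the corrected function `h(x,t) = (V̄_p(x+R,t) - C|x+R|^{p-δ})⁺`
has nonpositive mean drift above the ray `x = (c(p)+γ)√t`. -/
theorem corrected_supermartingale_drift
    [MeasureSpace Ω] [IsProbabilityMeasure (ℙ : Measure Ω)]
    (X : Ω → ℝ) (p δ : ℝ) (hp : 1 < p) (hδ0 : 0 < δ) (hδ : δ < min 1 (p - 1))
    (hmeas : Measurable X)
    (hmean : ∫ ω, X ω ∂ℙ = 0)
    (hvar : ∫ ω, (X ω) ^ 2 ∂ℙ = 1)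
    (hmomp : Integrable (fun ω => |X ω| ^ p) ℙ)
    (hmom2δ : Integrable (fun ω => |X ω| ^ (2 + δ)) ℙ)
    (γ : ℝ) (hγ : 0 < γ) :
    ∃ C : ℝ, 0 < C ∧ ∃ R : ℝ, 0 < R ∧
      ∀ t : ℝ, 0 ≤ t → ∀ x : ℝ, (cRoot p + γ) * Real.sqrt t ≤ x →
        (∫ ω, max (Vbar p (x + X ω + R) (t + 1)
            - C * |x + X ω + R| ^ (p - δ)) 0 ∂ℙ)
          ≤ max (Vbar p (x + R) t - C * |x + R| ^ (p - δ)) 0 := by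
  have hδ1 : δ < 1 := hδ.trans_le (min_le_left _ _)
  have hδp : δ < p - 1 := hδ.trans_le (min_le_right _ _)
  have hc := cRoot_pos hp
  obtain ⟨L, hL, hmaj⟩ := exists_step_majorant hp hδ0 hδ1 hδp hγ
  obtain ⟨K, hK0, hK⟩ := exists_V_time_increment_le p hc
  set m := (p - δ) * (p - δ - 1) / 4 with hm
  have hm0 : 0 < m := by
    have : 0 < p - δ - 1 := by linarith
    have : 0 < p - δ := by linarith
    positivity
  set M := (∫ ω, |X ω| ^ (2 + δ) ∂ℙ) + ∫ ω, |X ω| ^ p ∂ℙ with hM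
  have hM0 : 0 ≤ M := add_nonneg (integral_nonneg fun ω => by positivity)
    (integral_nonneg fun ω => by positivity)
  refine ⟨(K + L * M) / m + 1, by positivity, ?_⟩
  set C := (K + L * M) / m + 1 with hC
  have hC0 : 0 < C := by positivity
  obtain ⟨R, hR1, hRc, hR⟩ := hmaj C hC0
  refine ⟨R, by linarith, fun t ht x hx => ?_⟩
  have hst := Real.sqrt_nonneg t
  have hx0 : 0 ≤ x := (mul_nonneg (by linarith) hst).trans hx
  have hyray : (cRoot p + γ) * Real.sqrt t + R ≤ x + R := by linarith
  have hray : cRoot p * Real.sqrt t ≤ x + R := by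
    nlinarith [mul_nonneg hγ.le hst]
  have hray1 := mul_sqrt_add_one_le hc.le (by linarith) hRc hyray ht
  have hswap : ∀ ω, x + X ω + R = x + R + X ω := fun ω => by ring
  simp only [hswap]
  set y := x + R with hy
  have hy1 : 1 ≤ y := by linarith
  have hy0 : 0 < y := by linarith
  have hint2 : Integrable (fun ω => X ω ^ 2) ℙ := by
    by_contra h
    rw [integral_undef h] at hvar
    exact zero_ne_one hvar
  have hint1 : Integrable X ℙ :=
    ((memLp_two_iff_integrable_sq hmeas.aestronglyMeasurable).2 hint2).integrable one_le_two
  have hint0 := (hmom2δ.add hmomp).const_mul (y ^ (p - δ - 2))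
  set A := V p y (t + 1) - C * y ^ (p - δ) with hA
  set B := p * V (p - 1) y (t + 1) - C * ((p - δ) * y ^ (p - δ - 1)) with hB
  set D := p * (p - 1) / 2 * V (p - 2) y (t + 1) - C * (m * y ^ (p - δ - 2)) with hD
  have i1 : Integrable (fun ω => A + B * X ω) ℙ := (integrable_const A).add (hint1.const_mul B)
  have i2 : Integrable (fun ω => A + B * X ω + D * X ω ^ 2) ℙ := i1.add (hint2.const_mul D)
  have i3 : Integrable
      (fun ω => L * (y ^ (p - δ - 2) * (|X ω| ^ (2 + δ) + |X ω| ^ p))) ℙ := hint0.const_mul L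
  have hgint : Integrable (fun ω => stepMajorant p δ C m L t y (X ω)) ℙ := i2.add i3
  have hgval : ∫ ω, stepMajorant p δ C m L t y (X ω) ∂ℙ
      = A + D + L * (y ^ (p - δ - 2) * M) := by
    have e : ∀ ω, stepMajorant p δ C m L t y (X ω) = A + B * X ω + D * X ω ^ 2
        + L * (y ^ (p - δ - 2) * (|X ω| ^ (2 + δ) + |X ω| ^ p)) := fun ω => rfl
    simp only [e]
    rw [integral_add i2 i3, integral_add i1 (hint2.const_mul D),
      integral_add (integrable_const A) (hint1.const_mul B), integral_const_mul,
      integral_const_mul, integral_const_mul, integral_const_mul,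
      integral_add hmom2δ hmomp, hmean, hvar]
    simp [hM]
  calc ∫ ω, max (Vbar p (y + X ω) (t + 1) - C * |y + X ω| ^ (p - δ)) 0 ∂ℙ
      ≤ ∫ ω, stepMajorant p δ C m L t y (X ω) ∂ℙ :=
        integral_mono_of_nonneg (Eventually.of_forall fun ω => le_max_right _ _) hgint
          (Eventually.of_forall fun ω => hR t y (X ω) ht hyray)
    _ = A + D + L * (y ^ (p - δ - 2) * M) := hgval
    _ ≤ V p y t - C * y ^ (p - δ) := by
        have h1 := hK t y ht hy0 hray1
        have h2 : K * y ^ (p - 4) ≤ K * y ^ (p - δ - 2) :=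
          mul_le_mul_of_nonneg_left
            (Real.rpow_le_rpow_of_exponent_le hy1 (by linarith)) hK0
        have h3 : K + L * M ≤ C * m := by
          rw [hC, add_mul, div_mul_cancel₀ _ hm0.ne']
          linarith
        have h4 := mul_le_mul_of_nonneg_right h3
          (by positivity : 0 ≤ y ^ (p - δ - 2))
        linarith
    _ ≤ max (Vbar p y t - C * |y| ^ (p - δ)) 0 := by
        rw [show Vbar p y t = V p y t from if_pos hray, abs_of_pos hy0]
        exact le_max_left _ _
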